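/- Theorem 2 (upper bound, explicit form). For every user-to-cache association g, the average delay satisfies T̄(g) ≤ ((Λ−t)/(1+t)) · ( K_p/Λ + sqrt( ((Λ−1)/Λ) · Σ_{λ=1}^{Λ} ( σ_λ² + (μ_λ − K_p/Λ)² ) ) ). -/

import Mathlib

open Finset

noncomputable section

/-- Probability weight of an activity pattern `ω` under independent Bernoulli
activities with success probabilities `p`. -/
def wgt {K : ℕ} (p : Fin K → ℝ) (ω : Fin K → Bool) : ℝ :=
  ∏ k, if ω k then p k else 1 - p k

/-- Load of cache `c` under association `g` and activity pattern `ω`: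
the number of active users assigned to cache `c`. -/
def load {K Λ : ℕ} (g : Fin K → Fin Λ) (ω : Fin K → Bool) (c : Fin Λ) : ℕ :=
  ∑ k, if g k = c ∧ ω k = true then 1 else 0

/-- Decreasing rearrangement of a tuple of naturals, indexed by `ℕ`
(value `0` out of range): `sortDescN v 0` is the largest entry,
`sortDescN v (Λ-1)` the smallest. -/
def sortDescN {Λ : ℕ} (v : Fin Λ → ℕ) (i : ℕ) : ℕ :=
  if h : i < Λ then (v ∘ Tuple.sort v) (Fin.rev ⟨i, h⟩) else 0

/-- Expectation of a real-valued functional of the activity pattern. -/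
def expec {K : ℕ} (p : Fin K → ℝ) (f : (Fin K → Bool) → ℝ) : ℝ :=
  ∑ ω : Fin K → Bool, wgt p ω * f ω

/-- Average worst-case delay of association `g`:
`T̄(g) = ∑_{λ=1}^{Λ-t} E[l_λ] C(Λ-λ,t)/C(Λ,t)` (here `i = λ - 1` is 0-based). -/
def avgDelay {K Λ : ℕ} (p : Fin K → ℝ) (g : Fin K → Fin Λ) (t : ℕ) : ℝ :=
  ∑ i ∈ Finset.range (Λ - t),
    expec p (fun ω => (sortDescN (load g ω) i : ℝ)) * ((Λ - 1 - i).choose t : ℝ) /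
      (Λ.choose t : ℝ)

/-- `μ_λ`: expected number of active users assigned to cache `c`. -/
def muC {K Λ : ℕ} (p : Fin K → ℝ) (g : Fin K → Fin Λ) (c : Fin Λ) : ℝ :=
  ∑ k, if g k = c then p k else 0

/-- `σ_λ²`: variance of the number of active users assigned to cache `c`. -/
def sigma2C {K Λ : ℕ} (p : Fin K → ℝ) (g : Fin K → Fin Λ) (c : Fin Λ) : ℝ :=
  ∑ k, if g k = c then p k * (1 - p k) else 0

/-- `|G_λ|`: the number of users assigned to cache `c`. -/
def Gcard {K Λ : ℕ} (g : Fin K → Fin Λ) (c : Fin Λ) : ℕ :=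
  (Finset.univ.filter fun k => g k = c).card

/-- Binomial cumulative distribution function `F_bin(n,q,x)`. -/
def Fbin (n : ℕ) (q : ℝ) (x : ℕ) : ℝ :=
  ∑ i ∈ Finset.range (x + 1), (n.choose i : ℝ) * q ^ i * (1 - q) ^ (n - i)

/-- Real-valued indicator of the activity of user `k`. -/
def act {K : ℕ} (ω : Fin K → Bool) (k : Fin K) : ℝ :=
  if ω k then 1 else 0

section Expectation

variable {K : ℕ} (p : Fin K → ℝ)

lemma expec_add (f h : (Fin K → Bool) → ℝ) :
    expec p (fun ω => f ω + h ω) = expec p f + expec p h := by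
  simp [expec, mul_add, Finset.sum_add_distrib]

lemma expec_const_mul (a : ℝ) (f : (Fin K → Bool) → ℝ) :
    expec p (fun ω => a * f ω) = a * expec p f := by
  simp only [expec, Finset.mul_sum]
  exact Finset.sum_congr rfl fun ω _ => by ring

lemma expec_sum {ι : Type*} (s : Finset ι) (f : ι → (Fin K → Bool) → ℝ) :
    expec p (fun ω => ∑ i ∈ s, f i ω) = ∑ i ∈ s, expec p (f i) := by
  simp only [expec, Finset.mul_sum]
  exact Finset.sum_comm

lemma expec_prod_act (s : Finset (Fin K)) :
    expec p (fun ω => ∏ k ∈ s, act ω k) = ∏ k ∈ s, p k := by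
  have h := Finset.prod_univ_sum (fun _ : Fin K => (Finset.univ : Finset Bool))
    (fun k b => (if b then p k else 1 - p k) * (if k ∈ s then (if b then (1 : ℝ) else 0) else 1))
  rw [Fintype.piFinset_univ] at h
  calc expec p (fun ω => ∏ k ∈ s, act ω k) = _ := by
        refine Eq.trans (Finset.sum_congr rfl fun ω _ => ?_) h.symm
        rw [Finset.prod_mul_distrib, Finset.prod_ite_mem, Finset.univ_inter]
        rfl
    _ = ∏ k, if k ∈ s then p k else 1 :=
        Finset.prod_congr rfl fun k _ => by by_cases hk : k ∈ s <;> simp [hk]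
    _ = ∏ k ∈ s, p k := by rw [Finset.prod_ite_mem, Finset.univ_inter]

lemma expec_const (a : ℝ) : expec p (fun _ => a) = a := by
  have h := expec_const_mul p a (fun ω => ∏ k ∈ ∅, act ω k)
  rw [expec_prod_act] at h
  simpa using h

lemma expec_act (k : Fin K) : expec p (fun ω => act ω k) = p k := by
  simpa using expec_prod_act p {k}

lemma expec_act_mul_act (j k : Fin K) :
    expec p (fun ω => act ω j * act ω k) = if j = k then p k else p j * p k := by
  split_ifs with h
  · subst h
    have h : ∀ ω : Fin K → Bool, act ω j * act ω j = act ω j := fun ω => by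
      unfold act
      split_ifs <;> simp
    simp only [h, expec_act]
  · simpa [Finset.prod_pair h] using expec_prod_act p {j, k}

lemma expec_centered_act_mul (j k : Fin K) :
    expec p (fun ω => (act ω j - p j) * (act ω k - p k)) =
      if j = k then p k * (1 - p k) else 0 := by
  have h : (fun ω : Fin K → Bool => (act ω j - p j) * (act ω k - p k)) =
      fun ω => act ω j * act ω k + ((-p k) * act ω j + ((-p j) * act ω k + p j * p k)) := by
    funext ω
    ring
  rw [h, expec_add, expec_add, expec_add, expec_const_mul, expec_const_mul, expec_const,
    expec_act, expec_act, expec_act_mul_act]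
  split_ifs with hjk
  · subst hjk
    ring
  · ring

variable {p}

lemma wgt_nonneg (hp : ∀ k, 0 ≤ p k ∧ p k ≤ 1) (ω : Fin K → Bool) : 0 ≤ wgt p ω :=
  Finset.prod_nonneg fun k _ => by
    split_ifs
    · exact (hp k).1
    · exact sub_nonneg.2 (hp k).2

lemma expec_mono (hp : ∀ k, 0 ≤ p k ∧ p k ≤ 1) {f h : (Fin K → Bool) → ℝ}
    (hfh : ∀ ω, f ω ≤ h ω) : expec p f ≤ expec p h :=
  Finset.sum_le_sum fun ω _ => mul_le_mul_of_nonneg_left (hfh ω) (wgt_nonneg hp ω)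

lemma sq_expec_le (hp : ∀ k, 0 ≤ p k ∧ p k ≤ 1) (f : (Fin K → Bool) → ℝ) :
    expec p f ^ 2 ≤ expec p (fun ω => f ω ^ 2) := by
  have h := expec_mono hp (f := fun ω => 2 * expec p f * f ω + -expec p f ^ 2)
    (h := fun ω => f ω ^ 2) fun ω => by nlinarith [sq_nonneg (f ω - expec p f)]
  rw [expec_add, expec_const_mul, expec_const] at h
  linarith

end Expectation

section Load

variable {K Λ : ℕ} (p : Fin K → ℝ) (g : Fin K → Fin Λ)

lemma load_eq_sum_act (ω : Fin K → Bool) (c : Fin Λ) :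
    (load g ω c : ℝ) = ∑ k, (if g k = c then 1 else 0) * act ω k := by
  simp only [load, act]
  push_cast
  exact Finset.sum_congr rfl fun k _ => by by_cases h : g k = c <;> simp [h]

lemma sum_load_eq_sum_act (ω : Fin K → Bool) :
    ∑ c, (load g ω c : ℝ) = ∑ k, act ω k := by
  simp only [load_eq_sum_act]
  rw [Finset.sum_comm]
  simp

lemma expec_sum_load : expec p (fun ω => ∑ c, (load g ω c : ℝ)) = ∑ k, p k := by
  simp only [sum_load_eq_sum_act, expec_sum, expec_act]

lemma expec_sq_load_sub (c : Fin Λ) (a : ℝ) :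
    expec p (fun ω => ((load g ω c : ℝ) - a) ^ 2) =
      sigma2C p g c + (muC p g c - a) ^ 2 := by
  set e : Fin K → ℝ := fun k => if g k = c then 1 else 0 with he
  set d : ℝ := muC p g c - a with hd
  have hμ : muC p g c = ∑ k, e k * p k := by simp [muC, he]
  have h : (fun ω : Fin K → Bool => ((load g ω c : ℝ) - a) ^ 2) =
      fun ω => ∑ j, ∑ k, e j * e k * ((act ω j - p j) * (act ω k - p k)) +
        (2 * d * ∑ k, e k * (act ω k + -p k) + d ^ 2) := by
    funext ω
    have h₁ : (load g ω c : ℝ) - a = ∑ k, e k * (act ω k - p k) + d := by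
      rw [load_eq_sum_act, hd, hμ]
      simp only [mul_sub, Finset.sum_sub_distrib]
      ring
    have h₂ : (∑ k, e k * (act ω k - p k)) ^ 2 =
        ∑ j, ∑ k, e j * e k * ((act ω j - p j) * (act ω k - p k)) := by
      rw [sq, Finset.sum_mul_sum]
      exact Finset.sum_congr rfl fun j _ => Finset.sum_congr rfl fun k _ => by ring
    rw [h₁, ← h₂]
    simp only [← sub_eq_add_neg]
    ring
  rw [h, expec_add, expec_add, expec_const_mul, expec_const]
  simp only [expec_sum, expec_const_mul, expec_centered_act_mul, expec_add, expec_act,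
    expec_const]
  simp only [he, sigma2C, add_neg_cancel, mul_zero, Finset.sum_const_zero, zero_add, mul_ite,
    Finset.sum_ite_eq, Finset.mem_univ, if_true]
  congr 1
  exact Finset.sum_congr rfl fun k _ => by split_ifs <;> simp

end Load

lemma sortDescN_le_zero {Λ : ℕ} (v : Fin Λ → ℕ) (i : ℕ) : sortDescN v i ≤ sortDescN v 0 := by
  unfold sortDescN
  split_ifs with h h₀
  · exact Tuple.monotone_sort v (Fin.rev_le_rev.2 (Fin.mk_le_mk.2 (Nat.zero_le i)))
  · omega
  all_goals exact Nat.zero_le _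

lemma exists_eq_sortDescN_zero {Λ : ℕ} (hΛ : 0 < Λ) (v : Fin Λ → ℕ) :
    ∃ c, v c = sortDescN v 0 :=
  ⟨Tuple.sort v (Fin.rev ⟨0, hΛ⟩), by simp [sortDescN, hΛ]⟩

/-- Samuelson's inequality, relaxed to squared deviations from an arbitrary point `a`. -/
lemma sq_sub_mean_le {Λ : ℕ} (hΛ : 0 < Λ) (x : Fin Λ → ℝ) (c : Fin Λ) (a : ℝ) :
    (x c - (∑ i, x i) / Λ) ^ 2 ≤ ((Λ : ℝ) - 1) / Λ * ∑ i, (x i - a) ^ 2 := by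
  have hΛ₀ : (0 : ℝ) < Λ := Nat.cast_pos.2 hΛ
  set y : Fin Λ → ℝ := fun i => x i - a with hy
  have hxy : x c - (∑ i, x i) / Λ = y c - (∑ i, y i) / Λ := by
    simp only [hy, Finset.sum_sub_distrib, Finset.sum_const, Finset.card_univ, Fintype.card_fin,
      nsmul_eq_mul]
    field_simp
    ring
  rw [hxy]
  -- Cauchy–Schwarz for the vectors `y` and `e_c - 1/Λ`
  have hcs := Finset.sum_mul_sq_le_sq_mul_sq Finset.univ
    (fun i => (if i = c then 1 else 0) - 1 / (Λ : ℝ)) y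
  have h₁ : ∑ i, ((if i = c then 1 else 0) - 1 / (Λ : ℝ)) * y i = y c - (∑ i, y i) / Λ := by
    simp [sub_mul, Finset.sum_sub_distrib, ← Finset.mul_sum, div_eq_inv_mul]
  have h₂ : ∑ i : Fin Λ, ((if i = c then 1 else 0) - 1 / (Λ : ℝ)) ^ 2 = ((Λ : ℝ) - 1) / Λ := by
    have h : ∀ i : Fin Λ, ((if i = c then 1 else 0) - 1 / (Λ : ℝ)) ^ 2 =
        (if i = c then 1 - 2 / (Λ : ℝ) else 0) + 1 / (Λ : ℝ) ^ 2 := fun i => by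
      split_ifs <;> ring
    simp only [h, Finset.sum_add_distrib, Finset.sum_ite_eq', Finset.mem_univ, if_true,
      Finset.sum_const, Finset.card_univ, Fintype.card_fin, nsmul_eq_mul]
    field_simp
    ring
  rwa [h₁, h₂] at hcs

lemma sum_range_choose_div {Λ t : ℕ} (ht : t < Λ) :
    ∑ i ∈ Finset.range (Λ - t), ((Λ - 1 - i).choose t : ℝ) / (Λ.choose t : ℝ) =
      ((Λ : ℝ) - t) / (1 + t) := by
  have h : ∑ i ∈ Finset.range (Λ - t), (Λ - 1 - i).choose t = Λ.choose (t + 1) := by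
    obtain ⟨n, rfl⟩ : ∃ n, Λ = n + 1 := ⟨Λ - 1, by omega⟩
    rw [← Nat.sum_Icc_choose]
    refine Finset.sum_bij' (fun i _ => n - i) (fun j _ => n - j) ?_ ?_ ?_ ?_ ?_ <;>
      simp only [Finset.mem_range, Finset.mem_Icc] <;> intros <;> try omega
    rfl
  have h' : (Λ.choose (t + 1) : ℝ) * (t + 1) = Λ.choose t * (Λ - t) := by
    rw [← Nat.cast_sub ht.le]
    exact_mod_cast Nat.choose_succ_right_eq Λ t
  have hpos : (Λ.choose t : ℝ) ≠ 0 := Nat.cast_ne_zero.2 (Nat.choose_pos ht.le).ne'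
  rw [← Finset.sum_div, ← Nat.cast_sum, h, div_eq_div_iff hpos (by positivity)]
  linarith

lemma avgDelay_le_mul_expec_max {K Λ t : ℕ} (ht : t < Λ) {p : Fin K → ℝ}
    (hp : ∀ k, 0 ≤ p k ∧ p k ≤ 1) (g : Fin K → Fin Λ) :
    avgDelay p g t ≤
      ((Λ : ℝ) - t) / (1 + t) * expec p (fun ω => (sortDescN (load g ω) 0 : ℝ)) := by
  rw [← sum_range_choose_div ht, Finset.sum_mul]
  refine Finset.sum_le_sum fun i _ => ?_
  rw [mul_div_assoc, mul_comm]
  exact mul_le_mul_of_nonneg_left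
    (expec_mono hp fun ω => Nat.cast_le.2 (sortDescN_le_zero _ i)) (by positivity)

lemma expec_max_le {K Λ : ℕ} (hΛ : 0 < Λ) {p : Fin K → ℝ}
    (hp : ∀ k, 0 ≤ p k ∧ p k ≤ 1) (g : Fin K → Fin Λ) (a : ℝ) :
    expec p (fun ω => (sortDescN (load g ω) 0 : ℝ)) ≤
      (∑ k, p k) / (Λ : ℝ) +
        Real.sqrt ((((Λ : ℝ) - 1) / (Λ : ℝ)) *
          ∑ c : Fin Λ, (sigma2C p g c + (muC p g c - a) ^ 2)) := by
  set f : (Fin K → Bool) → ℝ := fun ω =>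
    (sortDescN (load g ω) 0 : ℝ) + (-(Λ : ℝ)⁻¹) * ∑ c, (load g ω c : ℝ) with hf
  have hEf : expec p f =
      expec p (fun ω => (sortDescN (load g ω) 0 : ℝ)) - (∑ k, p k) / (Λ : ℝ) := by
    rw [hf, expec_add, expec_const_mul, expec_sum_load]
    ring
  have hsq : expec p (fun ω => f ω ^ 2) ≤
      (((Λ : ℝ) - 1) / (Λ : ℝ)) * ∑ c : Fin Λ, (sigma2C p g c + (muC p g c - a) ^ 2) := by
    simp only [← expec_sq_load_sub, ← expec_sum, ← expec_const_mul]
    refine expec_mono hp fun ω => ?_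
    obtain ⟨c, hc⟩ := exists_eq_sortDescN_zero hΛ (load g ω)
    have h := sq_sub_mean_le hΛ (fun i => (load g ω i : ℝ)) c a
    rw [hc] at h
    convert h using 2
    simp only [hf]
    ring
  have h := Real.le_sqrt_of_sq_le ((sq_expec_le hp f).trans hsq)
  rw [hEf] at h
  linarith

/-- Theorem 2 (upper bound, explicit form). -/
theorem theorem2_upper_bound {K Λ t : ℕ} (hΛ : 2 ≤ Λ) (ht1 : 1 ≤ t) (ht2 : t ≤ Λ - 1)
    (p : Fin K → ℝ) (hp : ∀ k, 0 ≤ p k ∧ p k ≤ 1) (g : Fin K → Fin Λ) :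
    avgDelay p g t ≤
      ((Λ : ℝ) - t) / (1 + t) *
        ((∑ k, p k) / (Λ : ℝ) +
          Real.sqrt ((((Λ : ℝ) - 1) / (Λ : ℝ)) *
            ∑ c : Fin Λ, (sigma2C p g c + (muC p g c - (∑ k, p k) / (Λ : ℝ)) ^ 2))) := by
  have ht : t < Λ := by omega
  exact (avgDelay_le_mul_expec_max ht hp g).trans <| mul_le_mul_of_nonneg_left
    (expec_max_le (by omega) hp g _)
    (div_nonneg (sub_nonneg.2 (Nat.cast_le.2 ht.le)) (by positivity))

end
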